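/- Let τ lie in the complex upper half-plane and set x = v(τ)², y = v(2τ)². Then y² − (x² − 4x + 1)·y + x² = 0. -/

import Mathlib

/-- `qpow τ r = exp(2πi·r·τ)`, i.e. `q^r` where `q = exp(2πiτ)`. -/
noncomputable def qpow (τ : ℂ) (r : ℝ) : ℂ :=
  Complex.exp (2 * (Real.pi : ℂ) * Complex.I * (r : ℂ) * τ)

/-- The Kronecker symbol `(2/n)`: `+1` if `n ≡ ±1 (mod 8)`, `-1` if `n ≡ ±3 (mod 8)`,
`0` if `n` is even. -/
def chi8 (n : ℕ) : ℤ :=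
  if n % 8 = 1 ∨ n % 8 = 7 then 1 else if n % 8 = 3 ∨ n % 8 = 5 then -1 else 0

/-- Ramanujan's continued fraction value
`v(τ) = q^{1/2} ∏_{n≥1} (1 - q^n)^{χ₈(n)}`, `q = exp(2πiτ)`. -/
noncomputable def vRam (τ : ℂ) : ℂ :=
  qpow τ (1/2) * ∏' n : ℕ, (1 - qpow τ ((n : ℝ) + 1)) ^ chi8 (n + 1)

open Filter Topology

/-- The product `∏_{k≥0} (1 + Q^k w)`. -/
noncomputable def qProd (Q w : ℂ) : ℂ := ∏' k : ℕ, (1 + Q ^ k * w)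

lemma summable_norm_pow_mul {Q : ℂ} (hQ : ‖Q‖ < 1) (w : ℂ) : Summable fun k : ℕ ↦ ‖Q ^ k * w‖ := by
  simpa [norm_mul, norm_pow] using (summable_geometric_of_lt_one (norm_nonneg Q) hQ).mul_right ‖w‖

lemma tendsto_qProd {Q : ℂ} (hQ : ‖Q‖ < 1) (w : ℂ) :
    Tendsto (fun n ↦ ∏ k ∈ Finset.range n, (1 + Q ^ k * w)) atTop (𝓝 (qProd Q w)) :=
  (multipliable_one_add_of_summable (summable_norm_pow_mul hQ w)).hasProd.tendsto_prod_nat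

lemma one_add_pow_mul_ne_zero {Q w : ℂ} (hQ : ‖Q‖ ≤ 1) (hw : ‖w‖ < 1) (k : ℕ) :
    1 + Q ^ k * w ≠ 0 := by
  intro h
  have h1 : ‖Q ^ k * w‖ = 1 := by
    rw [show Q ^ k * w = -1 by linear_combination h]; simp
  rw [norm_mul, norm_pow] at h1
  have h2 : ‖Q‖ ^ k ≤ 1 := pow_le_one₀ (norm_nonneg _) hQ
  nlinarith [norm_nonneg w]

lemma qProd_ne_zero {Q w : ℂ} (hQ : ‖Q‖ < 1) (hw : ‖w‖ < 1) : qProd Q w ≠ 0 :=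
  tprod_one_add_ne_zero_of_summable (one_add_pow_mul_ne_zero hQ.le hw) (summable_norm_pow_mul hQ w)

lemma qProd_mul_qProd_neg {Q : ℂ} (hQ : ‖Q‖ < 1) (w : ℂ) :
    qProd Q w * qProd Q (-w) = qProd (Q ^ 2) (-w ^ 2) := by
  have hQ2 : ‖Q ^ 2‖ < 1 := by rw [norm_pow]; exact pow_lt_one₀ (norm_nonneg _) hQ two_ne_zero
  refine tendsto_nhds_unique ((tendsto_qProd hQ w).mul (tendsto_qProd hQ (-w))) ?_
  convert tendsto_qProd hQ2 (-w ^ 2) using 2 with n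
  rw [← Finset.prod_mul_distrib]
  exact Finset.prod_congr rfl fun k _ ↦ by ring

lemma qProd_eq_mul {Q : ℂ} (hQ : ‖Q‖ < 1) (w : ℂ) :
    qProd Q w = qProd (Q ^ 2) w * qProd (Q ^ 2) (Q * w) := by
  have hQ2 : ‖Q ^ 2‖ < 1 := by rw [norm_pow]; exact pow_lt_one₀ (norm_nonneg _) hQ two_ne_zero
  refine tendsto_nhds_unique
    ((tendsto_qProd hQ w).comp (tendsto_id.const_mul_atTop' (r := 2) two_pos)) ?_
  convert (tendsto_qProd hQ2 w).mul (tendsto_qProd hQ2 (Q * w)) using 2 with n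
  simp only [Function.comp, id]
  induction n with
  | zero => simp
  | succ n ih =>
    rw [show 2 * (n + 1) = 2 * n + 1 + 1 by ring, Finset.prod_range_succ _ (2 * n + 1),
      Finset.prod_range_succ _ (2 * n), ih, Finset.prod_range_succ _ n, Finset.prod_range_succ _ n]
    ring

/-- The general term `Q^{n(n-1)/2} z^n` of the theta series. -/
noncomputable def thetaTerm (Q z : ℂ) (n : ℤ) : ℂ := Q ^ (n * (n - 1) / 2) * z ^ n

lemma triangle_add (m n : ℤ) :
    (m + n) * (m + n - 1) / 2 = m * (m - 1) / 2 + n * (n - 1) / 2 + m * n := by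
  obtain ⟨a, ha⟩ := (Int.even_mul_pred_self m).two_dvd
  obtain ⟨b, hb⟩ := (Int.even_mul_pred_self n).two_dvd
  rw [show (m + n) * (m + n - 1) = 2 * (a + b + m * n) by linear_combination ha + hb, ha, hb]
  simp

lemma thetaTerm_add {Q z : ℂ} (hQ : Q ≠ 0) (hz : z ≠ 0) (m n : ℤ) :
    thetaTerm Q z (m + n) = thetaTerm Q z n * thetaTerm Q (z * Q ^ n) m := by
  simp only [thetaTerm]
  rw [triangle_add, zpow_add₀ hQ, zpow_add₀ hQ, zpow_add₀ hz, mul_zpow, ← zpow_mul, mul_comm n m]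
  ring

@[simp] lemma thetaTerm_zero (Q z : ℂ) : thetaTerm Q z 0 = 1 := by simp [thetaTerm]

@[simp] lemma thetaTerm_one (Q z : ℂ) : thetaTerm Q z 1 = z := by simp [thetaTerm]

lemma thetaTerm_ne_zero {Q z : ℂ} (hQ : Q ≠ 0) (hz : z ≠ 0) (n : ℤ) : thetaTerm Q z n ≠ 0 :=
  mul_ne_zero (zpow_ne_zero _ hQ) (zpow_ne_zero _ hz)

lemma summable_thetaTerm_nat {Q z : ℂ} (hQ0 : Q ≠ 0) (hQ : ‖Q‖ < 1) (hz : z ≠ 0) :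
    Summable fun n : ℕ ↦ ‖thetaTerm Q z n‖ := by
  refine summable_of_ratio_test_tendsto_lt_one zero_lt_one
    (Eventually.of_forall fun n ↦ norm_ne_zero_iff.mpr (thetaTerm_ne_zero hQ0 hz n)) ?_
  have h : Tendsto (fun n : ℕ ↦ ‖Q‖ ^ n * ‖z‖) atTop (𝓝 0) := by
    simpa using (tendsto_pow_atTop_nhds_zero_of_lt_one (norm_nonneg Q) hQ).mul_const ‖z‖
  refine h.congr fun n ↦ ?_
  have h0 : ‖thetaTerm Q z n‖ ≠ 0 := norm_ne_zero_iff.mpr (thetaTerm_ne_zero hQ0 hz n)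
  rw [norm_norm, norm_norm, eq_div_iff h0]
  push_cast
  rw [add_comm, thetaTerm_add hQ0 hz, thetaTerm_one, norm_mul, norm_mul, zpow_natCast, norm_pow]
  ring

lemma thetaTerm_neg {Q z : ℂ} (hQ : Q ≠ 0) (n : ℤ) :
    thetaTerm Q z (-n) = thetaTerm Q (Q / z) n := by
  have h : -n * (-n - 1) / 2 = n * (n - 1) / 2 + n := by
    rw [show -n * (-n - 1) = n * (n - 1) + n * 2 by ring, Int.add_mul_ediv_right _ _ two_ne_zero]
  rw [thetaTerm, thetaTerm, h, zpow_add₀ hQ, div_zpow, zpow_neg]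
  ring

lemma summable_norm_thetaTerm {Q z : ℂ} (hQ0 : Q ≠ 0) (hQ : ‖Q‖ < 1) (hz : z ≠ 0) :
    Summable fun n : ℤ ↦ ‖thetaTerm Q z n‖ := by
  refine Summable.of_nat_of_neg (summable_thetaTerm_nat hQ0 hQ hz) ?_
  simp only [thetaTerm_neg hQ0]
  exact summable_thetaTerm_nat hQ0 hQ (div_ne_zero hQ0 hz)

/-- The Gaussian binomial coefficient with base `Q`. -/
noncomputable def gaussBinom (Q : ℂ) : ℕ → ℕ → ℂ
  | _, 0 => 1
  | 0, _ + 1 => 0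
  | M + 1, j + 1 => gaussBinom Q M j + Q ^ (j + 1) * gaussBinom Q M (j + 1)

lemma gaussBinom_zero_right (Q : ℂ) (M : ℕ) : gaussBinom Q M 0 = 1 := by cases M <;> rfl

lemma gaussBinom_succ_succ (Q : ℂ) (M j : ℕ) :
    gaussBinom Q (M + 1) (j + 1) = gaussBinom Q M j + Q ^ (j + 1) * gaussBinom Q M (j + 1) := rfl

lemma gaussBinom_eq_zero_of_lt (Q : ℂ) {M j : ℕ} (h : M < j) : gaussBinom Q M j = 0 := by
  induction M generalizing j with
  | zero => obtain ⟨j, rfl⟩ := Nat.exists_eq_succ_of_ne_zero h.ne'; rfl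
  | succ M ih =>
    obtain ⟨j, rfl⟩ := Nat.exists_eq_succ_of_ne_zero (Nat.ne_of_gt (Nat.zero_lt_of_lt h))
    rw [Nat.succ_eq_add_one, gaussBinom_succ_succ, ih (by omega), ih (by omega)]
    simp

lemma prod_one_add_pow_mul_eq_sum {Q w : ℂ} (hQ : Q ≠ 0) (hw : w ≠ 0) (M : ℕ) :
    ∏ k ∈ Finset.range M, (1 + Q ^ k * w) =
      ∑ j ∈ Finset.range (M + 1), gaussBinom Q M j * thetaTerm Q w j := by
  induction M generalizing w with
  | zero => simp [gaussBinom_zero_right]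
  | succ M ih =>
    have h1 : ∀ j : ℕ, thetaTerm Q w (j + 1 : ℕ) = w * thetaTerm Q (w * Q) j := fun j ↦ by
      push_cast
      rw [thetaTerm_add hQ hw, thetaTerm_one, zpow_one]
    have h2 : ∀ j : ℕ, thetaTerm Q (w * Q) j = Q ^ j * thetaTerm Q w j := fun j ↦ by
      rw [thetaTerm, thetaTerm, mul_zpow, zpow_natCast, zpow_natCast]; ring
    have h3 := ih (mul_ne_zero hw hQ)
    rw [Finset.prod_range_succ', Finset.prod_congr rfl (fun k _ ↦
      show 1 + Q ^ (k + 1) * w = 1 + Q ^ k * (w * Q) by ring), h3, Finset.sum_range_succ' _ (M + 1)]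
    simp only [gaussBinom_succ_succ, add_mul, Finset.sum_add_distrib]
    have h4 : ∑ j ∈ Finset.range (M + 1), Q ^ (j + 1) * gaussBinom Q M (j + 1) *
        thetaTerm Q w (j + 1 : ℕ) + 1 =
        ∑ j ∈ Finset.range (M + 1), gaussBinom Q M j * thetaTerm Q (w * Q) j := by
      have := Finset.sum_range_succ' (fun j ↦ gaussBinom Q M j * thetaTerm Q (w * Q) j) (M + 1)
      rw [Finset.sum_range_succ, gaussBinom_eq_zero_of_lt Q (Nat.lt_succ_self M)] at this
      simp only [zero_mul, add_zero] at this
      rw [this]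
      simp only [h2, gaussBinom_zero_right, Nat.cast_zero, thetaTerm_zero, mul_one]
      congr 1
      exact Finset.sum_congr rfl fun j _ ↦ by ring
    have h5 : ∑ j ∈ Finset.range (M + 1), gaussBinom Q M j * thetaTerm Q w (j + 1 : ℕ) =
        (∑ j ∈ Finset.range (M + 1), gaussBinom Q M j * thetaTerm Q (w * Q) j) * w := by
      rw [Finset.sum_mul]
      exact Finset.sum_congr rfl fun j _ ↦ by rw [h1]; ring
    rw [h5, gaussBinom_zero_right, Nat.cast_zero, thetaTerm_zero, one_mul, add_assoc, h4]
    ring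

lemma gaussBinom_add_mul (Q : ℂ) (j k : ℕ) :
    gaussBinom Q (j + k) j * ((∏ i ∈ Finset.range j, (1 + Q ^ i * (-Q))) *
      ∏ i ∈ Finset.range k, (1 + Q ^ i * (-Q))) = ∏ i ∈ Finset.range (j + k), (1 + Q ^ i * (-Q)) := by
  generalize hM : j + k = M
  induction M generalizing j k with
  | zero => obtain ⟨rfl, rfl⟩ : j = 0 ∧ k = 0 := by omega
            simp [gaussBinom_zero_right]
  | succ M ih =>
    rcases j with _ | j
    · obtain rfl : k = M + 1 := by omega
      simp [gaussBinom_zero_right]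
    rcases k with _ | k
    · obtain rfl : j = M := by omega
      have := ih j 0 rfl
      rw [gaussBinom_succ_succ, gaussBinom_eq_zero_of_lt Q (Nat.lt_succ_self j),
        Finset.prod_range_succ]
      linear_combination (1 + Q ^ j * (-Q)) * this
    · have a := ih j (k + 1) (by omega)
      have b := ih (j + 1) k (by omega)
      obtain rfl : M = j + k + 1 := by omega
      rw [gaussBinom_succ_succ, Finset.prod_range_succ _ (j + k + 1)]
      rw [Finset.prod_range_succ _ k] at a ⊢
      rw [Finset.prod_range_succ _ j] at b ⊢
      linear_combination (1 + Q ^ j * (-Q)) * a + Q ^ (j + 1) * (1 + Q ^ k * (-Q)) * b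

lemma prod_mul_prod_eq_sum {Q z : ℂ} (hQ : Q ≠ 0) (hz : z ≠ 0) (N : ℕ) :
    (∏ k ∈ Finset.range N, (1 + Q ^ k * z)) * ∏ k ∈ Finset.range N, (1 + Q ^ k * (Q / z)) =
      ∑ j ∈ Finset.range (2 * N + 1), gaussBinom Q (2 * N) j * thetaTerm Q z (j - N) := by
  have hw (n : ℤ) : z * Q ^ n ≠ 0 := mul_ne_zero hz (zpow_ne_zero _ hQ)
  have hrev : ∏ k ∈ Finset.range N, (1 + Q ^ k * (z * Q ^ (-N : ℤ))) =
      thetaTerm Q (z * Q ^ (-N : ℤ)) N * ∏ k ∈ Finset.range N, (1 + Q ^ k * (Q / z)) := by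
    induction N with
    | zero => simp
    | succ N ih =>
      have hshift : z * Q ^ (-(N + 1 : ℕ) : ℤ) * Q = z * Q ^ (-N : ℤ) := by
        rw [mul_assoc, ← zpow_add_one₀ hQ]; congr 2; push_cast; ring
      have hinv : z * Q ^ (-(N + 1 : ℕ) : ℤ) * (Q ^ N * (Q / z)) = 1 := by
        rw [zpow_neg, zpow_natCast]; field_simp; ring
      rw [Finset.prod_range_succ', Finset.prod_range_succ _ N, Finset.prod_congr rfl (fun k _ ↦
        show 1 + Q ^ (k + 1) * (z * Q ^ (-(N + 1 : ℕ) : ℤ)) = 1 + Q ^ k * (z * Q ^ (-N : ℤ)) by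
          rw [← hshift]; ring), ih, Nat.cast_succ, thetaTerm_add hQ (by exact_mod_cast hw _),
        thetaTerm_one, zpow_one]
      rw [Nat.cast_succ] at hshift hinv
      rw [hshift]
      linear_combination (-thetaTerm Q (z * Q ^ (-N : ℤ)) N *
        ∏ k ∈ Finset.range N, (1 + Q ^ k * (Q / z))) * hinv
  have hC := thetaTerm_ne_zero hQ (hw (-N)) N
  have hfull := prod_one_add_pow_mul_eq_sum hQ (hw (-N)) (2 * N)
  rw [two_mul N, Finset.prod_range_add, hrev, ← two_mul] at hfull
  have hz' : z * Q ^ (-N : ℤ) * Q ^ (N : ℤ) = z := by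
    rw [mul_assoc, ← zpow_add₀ hQ]; simp
  have hhalf : ∏ k ∈ Finset.range N, (1 + Q ^ (N + k) * (z * Q ^ (-N : ℤ))) =
      ∏ k ∈ Finset.range N, (1 + Q ^ k * z) := by
    refine Finset.prod_congr rfl fun k _ ↦ ?_
    rw [zpow_natCast] at hz'
    linear_combination Q ^ k * hz'
  have hsum : ∀ j : ℕ, thetaTerm Q (z * Q ^ (-N : ℤ)) j =
      thetaTerm Q (z * Q ^ (-N : ℤ)) N * thetaTerm Q z (j - N) := fun j ↦ by
    conv_lhs => rw [← sub_add_cancel (j : ℤ) N, thetaTerm_add hQ (hw _), hz']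
  rw [hhalf, Finset.sum_congr rfl (fun j _ ↦ show gaussBinom Q (2 * N) j *
    thetaTerm Q (z * Q ^ (-N : ℤ)) j = thetaTerm Q (z * Q ^ (-N : ℤ)) N *
      (gaussBinom Q (2 * N) j * thetaTerm Q z (j - N)) by rw [hsum]; ring),
    ← Finset.mul_sum] at hfull
  refine mul_left_cancel₀ hC ?_
  rw [← hfull]
  ring

/-- The coefficient of `thetaTerm Q z n` in the finite form of the triple product. -/
noncomputable def centralGaussBinom (Q : ℂ) (N : ℕ) (n : ℤ) : ℂ :=
  if -N ≤ n then gaussBinom Q (2 * N) (n + N).toNat else 0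

lemma tsum_centralGaussBinom_mul {Q z : ℂ} (hQ : Q ≠ 0) (hz : z ≠ 0) (N : ℕ) :
    ∑' n : ℤ, centralGaussBinom Q N n * thetaTerm Q z n =
      (∏ k ∈ Finset.range N, (1 + Q ^ k * z)) * ∏ k ∈ Finset.range N, (1 + Q ^ k * (Q / z)) := by
  have hinj : Function.Injective fun j : ℕ ↦ (j : ℤ) - N := fun a b h ↦ by simpa using h
  rw [prod_mul_prod_eq_sum hQ hz, ← hinj.tsum_eq]
  · rw [tsum_eq_sum (s := Finset.range (2 * N + 1))]
    · exact Finset.sum_congr rfl fun j _ ↦ by simp [centralGaussBinom]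
    · intro j hj
      rw [Finset.mem_range, not_lt] at hj
      simp [centralGaussBinom, gaussBinom_eq_zero_of_lt Q (show 2 * N < j by omega)]
  · intro n hn
    by_cases h : -N ≤ n
    · exact ⟨(n + N).toNat, by simp only; omega⟩
    · simp [centralGaussBinom, h] at hn

lemma gaussBinom_add_eq {Q : ℂ} (hQ : ‖Q‖ < 1) (j k : ℕ) :
    gaussBinom Q (j + k) j = (∏ i ∈ Finset.range (j + k), (1 + Q ^ i * (-Q))) *
      ((∏ i ∈ Finset.range j, (1 + Q ^ i * (-Q)))⁻¹ *
        (∏ i ∈ Finset.range k, (1 + Q ^ i * (-Q)))⁻¹) := by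
  have h (n : ℕ) : ∏ i ∈ Finset.range n, (1 + Q ^ i * (-Q)) ≠ 0 :=
    Finset.prod_ne_zero_iff.mpr fun i _ ↦ one_add_pow_mul_ne_zero hQ.le (by rwa [norm_neg]) i
  have := gaussBinom_add_mul Q j k
  rw [← mul_inv, eq_mul_inv_iff_mul_eq₀ (mul_ne_zero (h j) (h k)), this]

lemma exists_norm_gaussBinom_le {Q : ℂ} (hQ : ‖Q‖ < 1) : ∃ C, ∀ M j, ‖gaussBinom Q M j‖ ≤ C := by
  have hlim := tendsto_qProd hQ (-Q)
  obtain ⟨A, hA⟩ := (Metric.isBounded_range_of_tendsto _ hlim).exists_norm_le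
  obtain ⟨B, hB⟩ := (Metric.isBounded_range_of_tendsto _
    (hlim.inv₀ (qProd_ne_zero hQ (by rwa [norm_neg])))).exists_norm_le
  have hA' (n : ℕ) := hA _ (Set.mem_range_self n)
  have hB' (n : ℕ) := hB _ (Set.mem_range_self n)
  have hA0 : 0 ≤ A := (norm_nonneg _).trans (hA' 0)
  have hB0 : 0 ≤ B := (norm_nonneg _).trans (hB' 0)
  refine ⟨A * (B * B), fun M j ↦ ?_⟩
  rcases lt_or_ge M j with h | h
  · rw [gaussBinom_eq_zero_of_lt Q h, norm_zero]
    positivity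
  · obtain ⟨k, rfl⟩ := Nat.exists_eq_add_of_le h
    rw [gaussBinom_add_eq hQ, norm_mul, norm_mul]
    exact mul_le_mul (hA' _) (mul_le_mul (hB' _) (hB' _) (norm_nonneg _) hB0) (by positivity) hA0

lemma tendsto_centralGaussBinom {Q : ℂ} (hQ : ‖Q‖ < 1) (n : ℤ) :
    Tendsto (fun N ↦ centralGaussBinom Q N n) atTop (𝓝 (qProd Q (-Q))⁻¹) := by
  have hlim := tendsto_qProd hQ (-Q)
  have h0 : qProd Q (-Q) ≠ 0 := qProd_ne_zero hQ (by rwa [norm_neg])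
  have hadd : Tendsto (fun N : ℕ ↦ (n + N).toNat) atTop atTop :=
    tendsto_atTop.mpr fun b ↦ eventually_atTop.mpr ⟨n.natAbs + b, fun N hN ↦ by omega⟩
  have hsub : Tendsto (fun N : ℕ ↦ (N - n).toNat) atTop atTop :=
    tendsto_atTop.mpr fun b ↦ eventually_atTop.mpr ⟨n.natAbs + b, fun N hN ↦ by omega⟩
  have hmain := (hlim.comp (tendsto_id.const_mul_atTop' (r := 2) two_pos)).mul
    (((hlim.inv₀ h0).comp hadd).mul ((hlim.inv₀ h0).comp hsub))
  rw [mul_inv_cancel_left₀ h0] at hmain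
  refine hmain.congr' (eventually_atTop.mpr ⟨n.natAbs, fun N hN ↦ ?_⟩)
  have hN2 : 2 * N = (n + N).toNat + (N - n).toNat := by omega
  simp only [Function.comp, id, centralGaussBinom]
  rw [if_pos (by omega), hN2, gaussBinom_add_eq hQ]

/-- The **Jacobi triple product** identity. -/
theorem qProd_mul_qProd_div {Q z : ℂ} (hQ0 : Q ≠ 0) (hQ : ‖Q‖ < 1) (hz : z ≠ 0) :
    qProd Q z * qProd Q (Q / z) = (qProd Q (-Q))⁻¹ * ∑' n : ℤ, thetaTerm Q z n := by
  obtain ⟨C, hC⟩ := exists_norm_gaussBinom_le hQ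
  have hC0 : 0 ≤ C := (norm_nonneg _).trans (hC 0 0)
  rw [← tsum_mul_left]
  refine tendsto_nhds_unique ((tendsto_qProd hQ z).mul (tendsto_qProd hQ (Q / z))) ?_
  simp only [← tsum_centralGaussBinom_mul hQ0 hz]
  refine tendsto_tsum_of_dominated_convergence
    ((summable_norm_thetaTerm hQ0 hQ hz).mul_left C)
    (fun n ↦ (tendsto_centralGaussBinom hQ n).mul_const _) (Eventually.of_forall fun N n ↦ ?_)
  rw [norm_mul]
  refine mul_le_mul_of_nonneg_right ?_ (norm_nonneg _)
  unfold centralGaussBinom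
  split_ifs
  · exact hC _ _
  · simpa using hC0

lemma tsum_thetaTerm_eq_even_add_odd {Q z : ℂ} (hQ0 : Q ≠ 0) (hQ : ‖Q‖ < 1) (hz : z ≠ 0) :
    ∑' n : ℤ, thetaTerm Q z n = ∑' n : ℤ, thetaTerm (Q ^ 4) (Q * z ^ 2) n +
      z * ∑' n : ℤ, thetaTerm (Q ^ 4) (Q ^ 3 * z ^ 2) n := by
  have he (n : ℤ) : thetaTerm Q z (2 * n) = thetaTerm (Q ^ 4) (Q * z ^ 2) n := by
    obtain ⟨a, ha⟩ := (Int.even_mul_pred_self n).two_dvd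
    have h1 : 2 * n * (2 * n - 1) / 2 = 4 * a + n := by
      rw [show 2 * n * (2 * n - 1) = 2 * (4 * a + n) by linear_combination 4 * ha]
      simp
    rw [thetaTerm, thetaTerm, h1, ha, Int.mul_ediv_cancel_left _ two_ne_zero, mul_zpow,
      zpow_add₀ hQ0, zpow_mul, zpow_mul]
    norm_cast
    ring
  have ho (n : ℤ) : thetaTerm Q z (2 * n + 1) = z * thetaTerm (Q ^ 4) (Q ^ 3 * z ^ 2) n := by
    rw [add_comm, thetaTerm_add hQ0 hz, thetaTerm_one, zpow_mul, he, thetaTerm, thetaTerm,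
      show Q ^ 3 * z ^ 2 = Q * z ^ 2 * Q ^ (2 : ℤ) by norm_cast; ring, mul_zpow (Q * z ^ 2)]
    ring
  have hs := (summable_norm_thetaTerm hQ0 hQ hz).of_norm
  have hie : Function.Injective fun n : ℤ ↦ 2 * n := fun a b h ↦ by simpa using h
  have hio : Function.Injective fun n : ℤ ↦ 2 * n + 1 := fun a b h ↦ by simpa using h
  have hcompl : IsCompl (Set.range fun n : ℤ ↦ 2 * n) (Set.range fun n : ℤ ↦ 2 * n + 1) := by
    rw [range_two_mul, range_two_mul_add_one]
    exact Int.isCompl_even_odd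
  have he' : HasSum (thetaTerm Q z ∘ (↑) : Set.range (fun n : ℤ ↦ 2 * n) → ℂ) _ :=
    hie.hasSum_range_iff.mpr (hs.comp_injective hie).hasSum
  have ho' : HasSum (thetaTerm Q z ∘ (↑) : Set.range (fun n : ℤ ↦ 2 * n + 1) → ℂ) _ :=
    hio.hasSum_range_iff.mpr (hs.comp_injective hio).hasSum
  rw [(he'.add_isCompl hcompl ho').tsum_eq, ← tsum_mul_left]
  simp [he, ho]

/-- The product of `1 - q^n` over `n ≡ ±1 (mod 8)`. -/
noncomputable def numProd (q : ℂ) : ℂ := qProd (q ^ 8) (-q) * qProd (q ^ 8) (-q ^ 7)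

/-- The product of `1 - q^n` over `n ≡ ±3 (mod 8)`. -/
noncomputable def denProd (q : ℂ) : ℂ := qProd (q ^ 8) (-q ^ 3) * qProd (q ^ 8) (-q ^ 5)

lemma norm_pow_lt_one {q : ℂ} (hq : ‖q‖ < 1) {n : ℕ} (hn : n ≠ 0) : ‖q ^ n‖ < 1 := by
  rw [norm_pow]
  exact pow_lt_one₀ (norm_nonneg _) hq hn

lemma denProd_ne_zero {q : ℂ} (hq : ‖q‖ < 1) : denProd q ≠ 0 := by
  have h8 := norm_pow_lt_one hq (n := 8) (by norm_num)
  refine mul_ne_zero (qProd_ne_zero h8 ?_) (qProd_ne_zero h8 ?_) <;> rw [norm_neg] <;>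
    exact norm_pow_lt_one hq (by norm_num)

lemma numProd_sq {q : ℂ} (hq : ‖q‖ < 1) : numProd (q ^ 2) = numProd q * numProd (-q) := by
  have h8 := norm_pow_lt_one hq (n := 8) (by norm_num)
  have h1 := qProd_mul_qProd_neg h8 (-q)
  have h7 := qProd_mul_qProd_neg h8 (-q ^ 7)
  simp only [numProd, Even.neg_pow (show Even 8 by decide), Odd.neg_pow (show Odd 7 by decide)]
  rw [mul_mul_mul_comm, h1, h7]
  congr 2 <;> ring

lemma denProd_sq {q : ℂ} (hq : ‖q‖ < 1) : denProd (q ^ 2) = denProd q * denProd (-q) := by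
  have h8 := norm_pow_lt_one hq (n := 8) (by norm_num)
  have h3 := qProd_mul_qProd_neg h8 (-q ^ 3)
  have h5 := qProd_mul_qProd_neg h8 (-q ^ 5)
  simp only [denProd, Even.neg_pow (show Even 8 by decide), Odd.neg_pow (show Odd 3 by decide),
    Odd.neg_pow (show Odd 5 by decide)]
  rw [mul_mul_mul_comm, h3, h5]
  congr 2 <;> ring

lemma qProd_neg_pow_four {q : ℂ} (hq : ‖q‖ < 1) :
    qProd (-q ^ 4) q * qProd (-q ^ 4) (-q ^ 3) = numProd (-q) * denProd q := by
  have h4 : ‖-q ^ 4‖ < 1 := by rw [norm_neg]; exact norm_pow_lt_one hq (by norm_num)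
  rw [qProd_eq_mul h4, qProd_eq_mul h4 (-q ^ 3), numProd, denProd,
    show (-q ^ 4) ^ 2 = q ^ 8 by ring, show (-q) ^ 8 = q ^ 8 by ring,
    show -q ^ 4 * q = -q ^ 5 by ring, show -q ^ 4 * -q ^ 3 = q ^ 7 by ring,
    show -(-q) ^ 7 = q ^ 7 by ring, neg_neg]
  ring

lemma denProd_add_mul_numProd {q : ℂ} (hq0 : q ≠ 0) (hq : ‖q‖ < 1) :
    denProd (q ^ 2) + q * numProd (q ^ 2) =
      qProd (-q ^ 4) (q ^ 4) / qProd (q ^ 16) (-q ^ 16) * (numProd (-q) * denProd q) := by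
  have h4 : ‖-q ^ 4‖ < 1 := by rw [norm_neg]; exact norm_pow_lt_one hq (by norm_num)
  have h40 : -q ^ 4 ≠ 0 := neg_ne_zero.mpr (pow_ne_zero _ hq0)
  have h16 : ‖q ^ 16‖ < 1 := norm_pow_lt_one hq (by norm_num)
  have h160 : q ^ 16 ≠ 0 := pow_ne_zero _ hq0
  have hS := qProd_mul_qProd_div h40 h4 hq0
  have hE := qProd_mul_qProd_div h160 h16 (neg_ne_zero.mpr (pow_ne_zero 6 hq0))
  have hO := qProd_mul_qProd_div h160 h16 (neg_ne_zero.mpr (pow_ne_zero 14 hq0))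
  have hsplit := tsum_thetaTerm_eq_even_add_odd h40 h4 hq0
  rw [show (-q ^ 4) ^ 4 = q ^ 16 by ring, show -q ^ 4 * q ^ 2 = -q ^ 6 by ring,
    show (-q ^ 4) ^ 3 * q ^ 2 = -q ^ 14 by ring] at hsplit
  rw [show -q ^ 4 / q = -q ^ 3 by field_simp, qProd_neg_pow_four hq, neg_neg, hsplit] at hS
  rw [show q ^ 16 / -q ^ 6 = -q ^ 10 by field_simp] at hE
  rw [show q ^ 16 / -q ^ 14 = -q ^ 2 by field_simp] at hO
  have hc : qProd (-q ^ 4) (q ^ 4) ≠ 0 := qProd_ne_zero h4 (norm_pow_lt_one hq (by norm_num))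
  rw [hS, numProd, denProd, show (q ^ 2) ^ 8 = q ^ 16 by ring, show -(q ^ 2) ^ 3 = -q ^ 6 by ring,
    show -(q ^ 2) ^ 5 = -q ^ 10 by ring, show -(q ^ 2) ^ 7 = -q ^ 14 by ring, hE,
    mul_comm (qProd _ (-q ^ 2)), hO]
  field_simp

lemma sq_div_sq_mul_one_add {q : ℂ} (hq0 : q ≠ 0) (hq : ‖q‖ < 1) :
    q * (numProd q / denProd q) ^ 2 * (1 + q * (numProd (q ^ 2) / denProd (q ^ 2))) =
      q * (numProd (q ^ 2) / denProd (q ^ 2)) *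
        (1 - q * (numProd (q ^ 2) / denProd (q ^ 2))) := by
  have hp := denProd_add_mul_numProd hq0 hq
  have hm := denProd_add_mul_numProd (neg_ne_zero.mpr hq0) (by rwa [norm_neg])
  simp only [Even.neg_pow (show Even 4 by decide), Even.neg_pow (show Even 16 by decide),
    Even.neg_pow (show Even 2 by decide), neg_neg] at hm
  have hD := denProd_ne_zero hq
  have hD' : denProd (-q) ≠ 0 := denProd_ne_zero (by rwa [norm_neg])
  generalize qProd (-q ^ 4) (q ^ 4) / qProd (q ^ 16) (-q ^ 16) = c at hp hm
  rw [numProd_sq hq, denProd_sq hq] at *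
  field_simp
  linear_combination numProd q * (numProd q * denProd (-q) * hp - numProd (-q) * denProd q * hm)

lemma qpow_natCast_add_one (τ : ℂ) (n : ℕ) : qpow τ ((n : ℝ) + 1) = qpow τ 1 ^ (n + 1) := by
  rw [qpow, qpow, ← Complex.exp_nat_mul]
  congr 1
  push_cast
  ring

lemma norm_qpow_one_lt_one {τ : ℂ} (hτ : 0 < τ.im) : ‖qpow τ 1‖ < 1 := by
  rw [qpow, Complex.norm_exp, Real.exp_lt_one_iff]
  simp
  positivity

lemma norm_one_sub_zpow_chi8_sub_one_le {q : ℂ} (hq : ‖q‖ < 1) (n : ℕ) :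
    ‖(1 - q ^ (n + 1)) ^ chi8 (n + 1) - 1‖ ≤ ‖q‖ ^ n * (1 - ‖q‖)⁻¹ := by
  have h1 : 1 ≤ (1 - ‖q‖)⁻¹ :=
    (one_le_inv₀ (sub_pos.mpr hq)).mpr (by linarith [norm_nonneg q])
  have hpow : ‖q ^ (n + 1)‖ ≤ ‖q‖ ^ n := by
    rw [norm_pow]; exact pow_le_pow_of_le_one (norm_nonneg _) hq.le (Nat.le_succ n)
  have h0 : 0 ≤ ‖q‖ ^ n := by positivity
  unfold chi8
  split_ifs
  · rw [zpow_one, sub_sub_cancel_left, norm_neg]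
    nlinarith
  · have hle : 1 - ‖q‖ ≤ ‖1 - q ^ (n + 1)‖ := by
      have h2 := norm_sub_norm_le (1 : ℂ) (q ^ (n + 1))
      have h3 : ‖q ^ (n + 1)‖ ≤ ‖q‖ := by
        rw [norm_pow]; exact pow_le_of_le_one (norm_nonneg _) hq.le (Nat.succ_ne_zero n)
      rw [norm_one] at h2
      linarith
    have hne : 1 - q ^ (n + 1) ≠ 0 := norm_pos_iff.mp ((sub_pos.mpr hq).trans_le hle)
    rw [zpow_neg_one, show (1 - q ^ (n + 1))⁻¹ - 1 = q ^ (n + 1) * (1 - q ^ (n + 1))⁻¹ by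
      field_simp; ring, norm_mul, norm_inv]
    exact mul_le_mul hpow (inv_anti₀ (sub_pos.mpr hq) hle) (by positivity) h0
  · simp only [zpow_zero, sub_self, norm_zero]
    positivity

lemma tprod_one_sub_zpow_chi8 {q : ℂ} (hq : ‖q‖ < 1) :
    ∏' n : ℕ, (1 - q ^ (n + 1)) ^ chi8 (n + 1) = numProd q / denProd q := by
  have h8 := norm_pow_lt_one hq (n := 8) (by norm_num)
  have hmul : Multipliable fun n : ℕ ↦ (1 - q ^ (n + 1)) ^ chi8 (n + 1) := by
    have := multipliable_one_add_of_summable (((summable_geometric_of_lt_one (norm_nonneg q)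
      hq).mul_right (1 - ‖q‖)⁻¹).of_nonneg_of_le (fun _ ↦ norm_nonneg _)
      (norm_one_sub_zpow_chi8_sub_one_le hq))
    simpa only [add_sub_cancel] using this
  refine tendsto_nhds_unique (hmul.hasProd.tendsto_prod_nat.comp
    (tendsto_id.const_mul_atTop' (r := 8) (by norm_num))) ?_
  refine (((tendsto_qProd h8 (-q)).mul (tendsto_qProd h8 (-q ^ 7))).div
    ((tendsto_qProd h8 (-q ^ 3)).mul (tendsto_qProd h8 (-q ^ 5))) (denProd_ne_zero hq)).congr
      fun N ↦ Eq.symm ?_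
  simp only [Function.comp, id, Pi.div_apply]
  induction N with
  | zero => simp
  | succ N ih =>
    have hχ : chi8 (8 * N + 0 + 1) = 1 ∧ chi8 (8 * N + 1 + 1) = 0 ∧ chi8 (8 * N + 2 + 1) = -1 ∧
        chi8 (8 * N + 3 + 1) = 0 ∧ chi8 (8 * N + 4 + 1) = -1 ∧ chi8 (8 * N + 5 + 1) = 0 ∧
        chi8 (8 * N + 6 + 1) = 1 ∧ chi8 (8 * N + 7 + 1) = 0 := by
      simp only [chi8]
      refine ⟨?_, ?_, ?_, ?_, ?_, ?_, ?_, ?_⟩ <;> split_ifs <;> omega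
    obtain ⟨h0, h1, h2, h3, h4, h5, h6, h7⟩ := hχ
    rw [Nat.mul_succ, Finset.prod_range_add, ih]
    simp only [Finset.prod_range_succ, Finset.prod_range_zero, h0, h1, h2, h3, h4, h5, h6, h7,
      zpow_one, zpow_zero, zpow_neg_one, one_mul, mul_one, div_eq_mul_inv, mul_inv]
    rw [show 1 + (q ^ 8) ^ N * -q = 1 - q ^ (8 * N + 0 + 1) by ring,
      show 1 + (q ^ 8) ^ N * -q ^ 7 = 1 - q ^ (8 * N + 6 + 1) by ring,
      show 1 + (q ^ 8) ^ N * -q ^ 3 = 1 - q ^ (8 * N + 2 + 1) by ring,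
      show 1 + (q ^ 8) ^ N * -q ^ 5 = 1 - q ^ (8 * N + 4 + 1) by ring]
    ring

lemma vRam_eq {τ : ℂ} (hτ : 0 < τ.im) :
    vRam τ = qpow τ (1 / 2) * (numProd (qpow τ 1) / denProd (qpow τ 1)) := by
  simp only [vRam, qpow_natCast_add_one, tprod_one_sub_zpow_chi8 (norm_qpow_one_lt_one hτ)]

lemma qpow_half_sq (τ : ℂ) : qpow τ (1 / 2) ^ 2 = qpow τ 1 := by
  rw [qpow, qpow, ← Complex.exp_nat_mul]
  congr 1
  push_cast
  ring

lemma qpow_two_mul_half (τ : ℂ) : qpow (2 * τ) (1 / 2) = qpow τ 1 := by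
  rw [qpow, qpow]
  congr 1
  push_cast
  ring

/-- If `τ` lies in the upper half-plane, then `v(τ)² (1 + v(2τ)) = v(2τ) (1 - v(2τ))`. -/
theorem vRam_sq_mul_one_add {τ : ℂ} (hτ : 0 < τ.im) :
    vRam τ ^ 2 * (1 + vRam (2 * τ)) = vRam (2 * τ) * (1 - vRam (2 * τ)) := by
  have h2τ : 0 < (2 * τ).im := by simpa using hτ
  have hsq : qpow (2 * τ) 1 = qpow τ 1 ^ 2 := by rw [← qpow_half_sq, qpow_two_mul_half]
  rw [vRam_eq hτ, vRam_eq h2τ, mul_pow, qpow_half_sq, qpow_two_mul_half, hsq]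
  exact sq_div_sq_mul_one_add (Complex.exp_ne_zero _) (norm_qpow_one_lt_one hτ)

/-- If `τ` lies in the upper half-plane, `x = v(τ)²` and `y = v(2τ)²`,
then `y² - (x² - 4x + 1)y + x² = 0`. -/
theorem v_sq_duplication (τ : ℂ) (hτ : 0 < τ.im) :
    (vRam (2 * τ) ^ 2) ^ 2 -
      ((vRam τ ^ 2) ^ 2 - 4 * vRam τ ^ 2 + 1) * vRam (2 * τ) ^ 2 + (vRam τ ^ 2) ^ 2 = 0 := by
  have h := vRam_sq_mul_one_add hτ
  generalize vRam τ ^ 2 = x at h ⊢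
  generalize vRam (2 * τ) = V at h ⊢
  have hV : 1 + V ≠ 0 := by
    intro h0
    obtain rfl : V = -1 := by linear_combination h0
    norm_num at h
  linear_combination (x * (1 - V) + V * (1 + V)) * h
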